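/- Let n ≥ 1, let D be the two-term cochain complex ℚ ⊕ sℚ over ℚ with differential sending the degree-0 generator 1 to the shifted generator s1, and equip D^{⊗n} with the natural Σ_n-action permuting tensor factors (with Koszul signs). Then D^{⊗n} is Σ_n-equivariantly isomorphic to the exterior algebra Λ(ℚ^n) with differential d(x) = Δ ∧ x, where Δ = e_1 + ⋯ + e_n is the sum of the standard basis vectors. Consequently, the cohomology H^*(D^{⊗n}) vanishes and the quotient complex D^{⊗n}/d(D^{⊗n}) is Σ_n-equivariantly isomorphic to Λ(ℚ^n/Δ), the exterior algebra on the quotient of the standard permutation representation by the diagonal. -/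

import Mathlib

/-!
STATEMENT 6: Let `D` be the two-term complex `ℚ ⊕ sℚ` with `d 1 = s1`.  Then `D^{⊗n}` (with the
Koszul-signed `Σ_n`-action permuting the factors) is `Σ_n`-equivariantly isomorphic, as a complex,
to the exterior algebra `Λ(ℚ^n)` with differential `d x = Δ ∧ x`, `Δ = e_1 + ⋯ + e_n`.
Consequently `H^*(D^{⊗n}) = 0` and `D^{⊗n}/d(D^{⊗n})` is `Σ_n`-equivariantly isomorphic to
`Λ(ℚ^n/Δ)`.

We realize `D^{⊗n}` concretely in its standard basis `{1, s1}^{⊗n}`: its underlying space is the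
space `(Fin n → Bool) → ℚ` of functions on the set of basis tensors (`true` marking an `s1`,
i.e. odd, factor); the differential and the Koszul-signed permutation action are given by the
usual explicit formulas on this basis.
-/

open scoped Classical

noncomputable section

/-- The underlying `ℚ`-vector space of `D^{⊗n}` in the basis `{1, s1}^{⊗n}`:  a basis vector is
recorded as the set of slots carrying `s1` (the odd generator). -/
abbrev Cube (n : ℕ) := (Fin n → Bool) → ℚ

/-- Pointwise rescaling by a function, as a linear map. -/
def scaleBy {I : Type*} (s : I → ℚ) : (I → ℚ) →ₗ[ℚ] (I → ℚ) :=
  LinearMap.pi fun c => s c • LinearMap.proj c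

/-- The Koszul sign picked up when `d` is applied in the `i`-th slot: `(-1)^{#odd slots before i}`. -/
def dSign (n : ℕ) (i : Fin n) (c : Fin n → Bool) : ℚ :=
  if c i = true then
    (-1 : ℚ) ^ (Finset.univ.filter fun j : Fin n => j < i ∧ c j = true).card
  else 0

/-- The differential of `D^{⊗n}`: apply `d_D` (sending `1` to `s1`) in each slot, with Koszul
signs.  On the dual/basis description: `(d f) c = ∑_{i : c i odd} ± f (c with slot i even)`. -/
def cubeD (n : ℕ) : Cube n →ₗ[ℚ] Cube n :=
  ∑ i : Fin n,
    (scaleBy (dSign n i)).comp (LinearMap.funLeft ℚ ℚ fun c => Function.update c i false)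

/-- The Koszul sign of the permutation `σ` acting on the basis tensor with odd-slot pattern
`b`: `(-1)^{#{i<j : σ i > σ j, slots i and j odd}}`. -/
def actSign (n : ℕ) (σ : Equiv.Perm (Fin n)) (b : Fin n → Bool) : ℚ :=
  (-1 : ℚ) ^ (Finset.univ.filter fun p : Fin n × Fin n =>
    p.1 < p.2 ∧ σ p.2 < σ p.1 ∧ b p.1 = true ∧ b p.2 = true).card

/-- The Koszul-signed action of `σ ∈ Σ_n` on `D^{⊗n}`, permuting the tensor factors. -/
def cubeAct (n : ℕ) (σ : Equiv.Perm (Fin n)) : Cube n →ₗ[ℚ] Cube n :=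
  (scaleBy fun c => actSign n σ (c ∘ σ)).comp (LinearMap.funLeft ℚ ℚ fun c => c ∘ σ)

/-- `Δ = e_1 + ⋯ + e_n = (1, …, 1) ∈ ℚ^n`. -/
def Δvec (n : ℕ) : Fin n → ℚ := fun _ => 1

/-- The differential `x ↦ Δ ∧ x` on `Λ(ℚ^n)`. -/
def extD (n : ℕ) : ExteriorAlgebra ℚ (Fin n → ℚ) →ₗ[ℚ] ExteriorAlgebra ℚ (Fin n → ℚ) :=
  LinearMap.mulLeft ℚ (ExteriorAlgebra.ι ℚ (Δvec n))

/-- The permutation action of `σ` on `Λ(ℚ^n)`, induced by `e_i ↦ e_{σ i}`,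
i.e. `v ↦ v ∘ σ⁻¹` on `ℚ^n`. -/
def extAct (n : ℕ) (σ : Equiv.Perm (Fin n)) :
    ExteriorAlgebra ℚ (Fin n → ℚ) →ₗ[ℚ] ExteriorAlgebra ℚ (Fin n → ℚ) :=
  (ExteriorAlgebra.map (LinearMap.funLeft ℚ ℚ ⇑σ⁻¹)).toLinearMap

/-- The quotient `ℚ^n/Δ` (the standard representation of `Σ_n`). -/
abbrev StdRep (n : ℕ) := (Fin n → ℚ) ⧸ Submodule.span ℚ {Δvec n}

/-- The induced permutation action on `ℚ^n/Δ`. -/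
def stdAct (n : ℕ) (σ : Equiv.Perm (Fin n)) : StdRep n →ₗ[ℚ] StdRep n :=
  Submodule.mapQ _ _ (LinearMap.funLeft ℚ ℚ ⇑σ⁻¹) (by
    rw [Submodule.span_le]
    rintro x rfl
    exact Submodule.mem_comap.2 (Submodule.subset_span rfl))

/-- The induced action of `σ` on `Λ(ℚ^n/Δ)`. -/
def extQAct (n : ℕ) (σ : Equiv.Perm (Fin n)) :
    ExteriorAlgebra ℚ (StdRep n) →ₗ[ℚ] ExteriorAlgebra ℚ (StdRep n) :=
  (ExteriorAlgebra.map (stdAct n σ)).toLinearMap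

/-- creation operator in slot `i` -/
def aOp (n : ℕ) (i : Fin n) : Cube n →ₗ[ℚ] Cube n :=
  (scaleBy (dSign n i)).comp (LinearMap.funLeft ℚ ℚ fun c => Function.update c i false)

lemma aOp_apply (n : ℕ) (i : Fin n) (f : Cube n) (c : Fin n → Bool) :
    aOp n i f c = dSign n i c * f (Function.update c i false) := by
  simp [aOp, scaleBy, LinearMap.funLeft_apply]

lemma cubeAct_apply (n : ℕ) (σ : Equiv.Perm (Fin n)) (f : Cube n) (c : Fin n → Bool) :
    cubeAct n σ f c = actSign n σ (c ∘ σ) * f (c ∘ σ) := by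
  simp [cubeAct, scaleBy, LinearMap.funLeft_apply]

lemma dSign_false (n : ℕ) (i : Fin n) (c : Fin n → Bool) (h : c i = false) :
    dSign n i c = 0 := by simp [dSign, h]

lemma dSign_update_lt (n : ℕ) (i j : Fin n) (c : Fin n → Bool) (hij : i < j) (h : c i = true) :
    dSign n j (Function.update c i false) = - dSign n j c := by
  have e : (Finset.univ.filter fun k : Fin n => k < j ∧ c k = true)
      = insert i (Finset.univ.filter fun k : Fin n =>
          k < j ∧ Function.update c i false k = true) := by
    ext k
    by_cases hk : k = i
    · subst hk; simp [hij, h]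
    · simp [hk]
  have e2 : (Function.update c i false) j = c j := by simp [hij.ne']
  unfold dSign
  rw [e2, e, Finset.card_insert_of_notMem (by simp)]
  split_ifs <;> simp [pow_succ]

lemma dSign_update_gt (n : ℕ) (i j : Fin n) (c : Fin n → Bool) (hij : j < i) :
    dSign n j (Function.update c i false) = dSign n j c := by
  have e : (Finset.univ.filter fun k : Fin n => k < j ∧ c k = true)
      = (Finset.univ.filter fun k : Fin n =>
          k < j ∧ Function.update c i false k = true) := by
    ext k
    by_cases hk : k = i
    · subst hk; simp [hij.not_gt]
    · simp [hk]
  have e2 : (Function.update c i false) j = c j := by simp [hij.ne]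
  unfold dSign
  rw [e2, e]

lemma dSign_anti (n : ℕ) (i j : Fin n) (c : Fin n → Bool) (hij : i < j) :
    dSign n i c * dSign n j (Function.update c i false)
      = - (dSign n j c * dSign n i (Function.update c j false)) := by
  rw [dSign_update_gt n j i c hij]
  by_cases h : c i = true
  · rw [dSign_update_lt n i j c hij h]; ring
  · rw [dSign_false n i c (by simpa using h)]; ring

lemma aOp_anti (n : ℕ) (i j : Fin n) : aOp n i * aOp n j = - (aOp n j * aOp n i) := by
  refine LinearMap.ext fun f => funext fun c => ?_
  simp only [Module.End.mul_apply, LinearMap.neg_apply, Pi.neg_apply,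
    aOp_apply, ← mul_assoc]
  rcases lt_trichotomy i j with h | h | h
  · rw [dSign_anti n i j c h, Function.update_comm h.ne]; ring
  · subst h
    rw [dSign_false n i (Function.update c i false) (by simp)]; simp
  · rw [dSign_anti n j i c h, Function.update_comm h.ne]; ring

/-- the operator attached to a vector -/
def lOp (n : ℕ) : (Fin n → ℚ) →ₗ[ℚ] Module.End ℚ (Cube n) :=
  ∑ i : Fin n, (LinearMap.proj i : (Fin n → ℚ) →ₗ[ℚ] ℚ).smulRight (aOp n i)

lemma lOp_apply (n : ℕ) (v : Fin n → ℚ) : lOp n v = ∑ i, v i • aOp n i := by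
  simp [lOp, LinearMap.sum_apply]

lemma lOp_sq (n : ℕ) (v : Fin n → ℚ) : lOp n v * lOp n v = 0 := by
  have h : lOp n v * lOp n v = - (lOp n v * lOp n v) := by
    conv_lhs => rw [lOp_apply, Finset.sum_mul_sum, Finset.sum_comm]
    rw [lOp_apply, Finset.sum_mul_sum, ← Finset.sum_neg_distrib]
    refine Finset.sum_congr rfl fun i _ => ?_
    rw [← Finset.sum_neg_distrib]
    refine Finset.sum_congr rfl fun j _ => ?_
    rw [smul_mul_smul_comm, smul_mul_smul_comm, aOp_anti n j i, mul_comm (v j), smul_neg]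
  have h2 : (2 : ℚ) • (lOp n v * lOp n v) = 0 := by
    rw [two_smul]; nth_rewrite 1 [h]; exact neg_add_cancel _
  exact (smul_eq_zero.mp h2).resolve_left two_ne_zero

lemma lOp_Δ (n : ℕ) : lOp n (Δvec n) = cubeD n := by
  rw [lOp_apply]; simp [Δvec, cubeD, aOp]

/-- the vacuum -/
def vac (n : ℕ) : Cube n := Pi.single (fun _ => false) 1

/-- the comparison map -/
def Θ (n : ℕ) : ExteriorAlgebra ℚ (Fin n → ℚ) →ₗ[ℚ] Cube n :=
  (LinearMap.applyₗ (vac n)).comp (ExteriorAlgebra.lift ℚ ⟨lOp n, lOp_sq n⟩).toLinearMap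

lemma Θ_ι_mul (n : ℕ) (v : Fin n → ℚ) (x) :
    Θ n (ExteriorAlgebra.ι ℚ v * x) = lOp n v (Θ n x) := by
  simp [Θ]

lemma Θ_one (n : ℕ) : Θ n 1 = vac n := by simp [Θ]

lemma lOp_single (n : ℕ) (i : Fin n) : lOp n (Pi.single i 1) = aOp n i := by
  rw [lOp_apply, Finset.sum_eq_single i] <;> simp +contextual [Pi.single_apply]

lemma aOp_single (n : ℕ) (i : Fin n) (b : Fin n → Bool) (h : b i = true) :
    aOp n i (Pi.single (Function.update b i false) 1) = dSign n i b • Pi.single b (1 : ℚ) := by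
  ext c
  rw [aOp_apply]
  by_cases hc : c i = true
  · by_cases hcb : c = b
    · subst hcb; simp
    · have : Function.update c i false ≠ Function.update b i false := by
        intro h'
        apply hcb
        ext k
        by_cases hk : k = i
        · subst hk; rw [hc, h]
        · have := congrFun h' k
          simp only [Function.update_of_ne hk] at this
          rw [this]
      simp [Pi.single_apply, this, hcb]
  · have hcb : c ≠ b := by rintro rfl; exact hc h
    rw [dSign_false n i c (by simpa using hc)]
    simp [Pi.single_apply, hcb]

lemma single_mem (n : ℕ) (m : ℕ) : ∀ b : Fin n → Bool,
    (Finset.univ.filter fun i => b i = true).card = m →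
    (Pi.single b 1 : Cube n) ∈ LinearMap.range (Θ n) := by
  induction m with
  | zero =>
    intro b hb
    have : b = fun _ => false := by
      ext i
      have := Finset.filter_eq_empty_iff.mp (Finset.card_eq_zero.mp hb) (Finset.mem_univ i)
      simpa using this
    subst this
    exact ⟨1, Θ_one n⟩
  | succ m ih =>
    intro b hb
    obtain ⟨i, hi⟩ := Finset.card_pos.mp (by rw [hb]; exact Nat.succ_pos m)
    have hi' : b i = true := by simpa using hi
    have e : (Finset.univ.filter fun k => Function.update b i false k = true)
        = (Finset.univ.filter fun k => b k = true).erase i := by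
      ext k
      by_cases hk : k = i
      · subst hk; simp
      · simp [hk]
    obtain ⟨x, hx⟩ := ih (Function.update b i false)
      (by rw [e, Finset.card_erase_of_mem hi, hb]; rfl)
    have hne : dSign n i b ≠ 0 := by simp [dSign, hi']
    refine ⟨(dSign n i b)⁻¹ • (ExteriorAlgebra.ι ℚ (Pi.single i 1) * x), ?_⟩
    rw [map_smul, Θ_ι_mul, lOp_single, hx, aOp_single n i b hi', smul_smul, inv_mul_cancel₀ hne,
      one_smul]

lemma Θ_surj (n : ℕ) : Function.Surjective (Θ n) := by
  rw [← LinearMap.range_eq_top, eq_top_iff, ← (Pi.basisFun ℚ (Fin n → Bool)).span_eq,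
    Submodule.span_le]
  rintro _ ⟨b, rfl⟩
  simpa using single_mem n _ b rfl

lemma Θ_bij (n : ℕ) : Function.Bijective (Θ n) := by
  let B := (Pi.basisFun ℚ (Fin n)).ExteriorAlgebra
  haveI : FiniteDimensional ℚ (ExteriorAlgebra ℚ (Fin n → ℚ)) := Module.Finite.of_basis B
  have h : Module.finrank ℚ (ExteriorAlgebra ℚ (Fin n → ℚ)) = Module.finrank ℚ (Cube n) := by
    rw [Module.finrank_eq_card_basis B]
    simp
  exact ⟨(LinearMap.injective_iff_surjective_of_finrank_eq_finrank h).mpr (Θ_surj n), Θ_surj n⟩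

lemma Θ_D (n : ℕ) (x) : Θ n (extD n x) = cubeD n (Θ n x) := by
  rw [extD, LinearMap.mulLeft_apply, Θ_ι_mul, lOp_Δ]

lemma sign_key (n : ℕ) (σ : Equiv.Perm (Fin n)) (i : Fin n) (c : Fin n → Bool) :
    actSign n σ (c ∘ σ) * dSign n i (c ∘ σ)
      = dSign n (σ i) c * actSign n σ (Function.update (c ∘ σ) i false) := by
  by_cases h : c (σ i) = true
  swap
  · rw [dSign_false n i _ (by simpa using h), dSign_false n (σ i) c (by simpa using h)]; simp
  set A := (Finset.univ.filter fun j : Fin n => j < i ∧ σ i < σ j ∧ c (σ j) = true) with hA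
  set B := (Finset.univ.filter fun j : Fin n => i < j ∧ σ j < σ i ∧ c (σ j) = true) with hB
  set C := (Finset.univ.filter fun j : Fin n => j < i ∧ σ j < σ i ∧ c (σ j) = true) with hC
  have h1 : (Finset.univ.filter fun j : Fin n => j < i ∧ (c ∘ σ) j = true).card
      = A.card + C.card := by
    rw [← Finset.card_union_of_disjoint]
    · congr 1
      ext j
      have : σ i = σ j ↔ i = j := σ.apply_eq_iff_eq
      simp only [hA, hC, Finset.mem_filter, Finset.mem_univ, true_and, Finset.mem_union,
        Function.comp]
      grind
    · rw [Finset.disjoint_left]; intro j; simp only [hA, hC, Finset.mem_filter]; grind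
  have h2 : (Finset.univ.filter fun k : Fin n => k < σ i ∧ c k = true).card
      = B.card + C.card := by
    rw [← Finset.card_union_of_disjoint]
    · symm
      apply Finset.card_bij (fun j _ => σ j)
      · intro j; simp only [hB, hC, Finset.mem_filter, Finset.mem_union]; grind
      · intro a _ b _ hab; exact σ.injective hab
      · intro k hk
        refine ⟨σ.symm k, ?_, by simp⟩
        have hk' : k < σ i ∧ c k = true := by simpa using hk
        have : σ.symm k ≠ i := by rintro rfl; simp at hk'
        simp only [hB, hC, Finset.mem_filter, Finset.mem_union, Finset.mem_univ, true_and,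
          Equiv.apply_symm_apply]
        grind
    · rw [Finset.disjoint_left]; intro j; simp only [hB, hC, Finset.mem_filter]; grind
  have h3 : (Finset.univ.filter fun p : Fin n × Fin n =>
        p.1 < p.2 ∧ σ p.2 < σ p.1 ∧ (c ∘ σ) p.1 = true ∧ (c ∘ σ) p.2 = true).card
      = (Finset.univ.filter fun p : Fin n × Fin n =>
        p.1 < p.2 ∧ σ p.2 < σ p.1 ∧ Function.update (c ∘ σ) i false p.1 = true ∧
          Function.update (c ∘ σ) i false p.2 = true).card + (A.card + B.card) := by
    rw [← Finset.card_image_of_injective A (f := fun j => (j, i)) (fun a b hab => by simpa using hab),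
      ← Finset.card_image_of_injective B (f := fun j => (i, j)) (fun a b hab => by simpa using hab),
      ← Finset.card_union_of_disjoint, ← Finset.card_union_of_disjoint]
    · congr 1
      ext ⟨j, k⟩
      simp only [hA, hB, Finset.mem_filter, Finset.mem_univ, true_and, Finset.mem_union,
        Finset.mem_image, Function.comp, Prod.mk.injEq, Function.update_apply]
      grind
    · rw [Finset.disjoint_left]
      rintro ⟨j, k⟩
      simp only [hA, hB, Finset.mem_filter, Finset.mem_univ, true_and, Finset.mem_union,
        Finset.mem_image, Function.comp, Prod.mk.injEq, Function.update_apply]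
      grind
    · rw [Finset.disjoint_left]
      rintro ⟨j, k⟩
      simp only [hA, hB, Finset.mem_filter, Finset.mem_univ, true_and,
        Finset.mem_image, Prod.mk.injEq]
      grind
  unfold actSign dSign
  rw [if_pos (show (c ∘ σ) i = true from h), if_pos h, h1, h2, h3, ← pow_add, ← pow_add]
  rw [show ∀ N a b c : ℕ, N + (a + b) + (a + c) = (b + c + N) + 2 * a by intros; ring,
    pow_add, pow_mul]
  simp

lemma cubeAct_aOp (n : ℕ) (σ : Equiv.Perm (Fin n)) (i : Fin n) (f : Cube n) :
    cubeAct n σ (aOp n i f) = aOp n (σ i) (cubeAct n σ f) := by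
  ext c
  have e : Function.update c (σ i) false ∘ σ = Function.update (c ∘ σ) i false := by
    ext k; simp [Function.update_apply]
  rw [cubeAct_apply, aOp_apply, aOp_apply, cubeAct_apply, e, ← mul_assoc, ← mul_assoc, sign_key]

lemma cubeAct_lOp (n : ℕ) (σ : Equiv.Perm (Fin n)) (v : Fin n → ℚ) (f : Cube n) :
    cubeAct n σ (lOp n v f) = lOp n (LinearMap.funLeft ℚ ℚ ⇑σ⁻¹ v) (cubeAct n σ f) := by
  rw [lOp_apply, lOp_apply,
    ← Equiv.sum_comp σ (fun i => LinearMap.funLeft ℚ ℚ ⇑σ⁻¹ v i • aOp n i)]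
  simp [LinearMap.sum_apply, map_sum, cubeAct_aOp, LinearMap.funLeft_apply]

lemma cubeAct_vac (n : ℕ) (σ : Equiv.Perm (Fin n)) : cubeAct n σ (vac n) = vac n := by
  ext c
  rw [cubeAct_apply]
  by_cases h : c = fun _ => false
  · subst h
    simp [vac, actSign, Function.comp_def]
  · have : c ∘ σ ≠ fun _ => false := by
      intro h'
      apply h
      ext k
      have := congrFun h' (σ.symm k)
      simpa using this
    simp [vac, Pi.single_apply, h, this]

lemma Θ_act (n : ℕ) (σ : Equiv.Perm (Fin n)) (x) :
    Θ n (extAct n σ x) = cubeAct n σ (Θ n x) := by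
  induction x using CliffordAlgebra.left_induction with
  | algebraMap r =>
    change Θ n (ExteriorAlgebra.map _ (algebraMap ℚ (ExteriorAlgebra ℚ (Fin n → ℚ)) r))
      = cubeAct n σ (Θ n (algebraMap ℚ (ExteriorAlgebra ℚ (Fin n → ℚ)) r))
    rw [AlgHom.commutes, Algebra.algebraMap_eq_smul_one, map_smul, map_smul, Θ_one, cubeAct_vac]
  | add x y hx hy => simp only [map_add, hx, hy]
  | ι_mul x v hx =>
    change Θ n (ExteriorAlgebra.map _ (ExteriorAlgebra.ι ℚ v * x))
      = cubeAct n σ (Θ n (ExteriorAlgebra.ι ℚ v * x))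
    rw [map_mul, ExteriorAlgebra.map_apply_ι, Θ_ι_mul, Θ_ι_mul, cubeAct_lOp, ← hx]
    rfl

lemma extD_sq (n : ℕ) (x) : extD n (extD n x) = 0 := by
  simp [extD, ← mul_assoc]

lemma extD_exact (n : ℕ) (hn : 1 ≤ n) (x) (hx : extD n x = 0) :
    x ∈ LinearMap.range (extD n) := by
  let p : Module.Dual ℚ (Fin n → ℚ) := LinearMap.proj ⟨0, hn⟩
  refine ⟨CliffordAlgebra.contractLeft (Q := 0) p x, ?_⟩
  have h := CliffordAlgebra.contractLeft_ι_mul (Q := 0) p (Δvec n) x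
  have h0 : CliffordAlgebra.ι (0 : QuadraticForm ℚ (Fin n → ℚ)) (Δvec n) * x = 0 := hx
  have hp : p (Δvec n) = 1 := rfl
  rw [h0, map_zero, hp, one_smul] at h
  exact (sub_eq_zero.mp h.symm).symm

/-- quotient map on exterior algebras -/
abbrev qMap (n : ℕ) : ExteriorAlgebra ℚ (Fin n → ℚ) →ₐ[ℚ] ExteriorAlgebra ℚ (StdRep n) :=
  ExteriorAlgebra.map (Submodule.span ℚ {Δvec n}).mkQ

/-- section of the quotient map -/
def sec (n : ℕ) (hn : 1 ≤ n) : StdRep n →ₗ[ℚ] (Fin n → ℚ) :=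
  Submodule.liftQ _ (LinearMap.id - (LinearMap.proj (⟨0, hn⟩ : Fin n)).smulRight (Δvec n)) (by
    rw [Submodule.span_le]
    rintro x rfl
    simp [Δvec])

lemma sec_mk (n : ℕ) (hn : 1 ≤ n) (v : Fin n → ℚ) :
    sec n hn ((Submodule.span ℚ {Δvec n}).mkQ v) = v - v ⟨0, hn⟩ • Δvec n := by
  simp [sec]

lemma range_mul (n : ℕ) (v : Fin n → ℚ) (x) (hx : x ∈ LinearMap.range (extD n)) :
    ExteriorAlgebra.ι ℚ v * x ∈ LinearMap.range (extD n) := by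
  obtain ⟨y, rfl⟩ := hx
  refine ⟨- (ExteriorAlgebra.ι ℚ v * y), ?_⟩
  have := ExteriorAlgebra.ι_add_mul_swap (R := ℚ) v (Δvec n)
  simp only [extD, LinearMap.mulLeft_apply]
  rw [← mul_assoc, eq_neg_of_add_eq_zero_left this, neg_mul, mul_neg, mul_assoc]

lemma sec_alg (n : ℕ) (v : Fin n → ℚ) (r : ℚ) (x y : ExteriorAlgebra ℚ (Fin n → ℚ)) :
    ExteriorAlgebra.ι ℚ (v - r • Δvec n) * y - ExteriorAlgebra.ι ℚ v * x
      = ExteriorAlgebra.ι ℚ (v - r • Δvec n) * (y - x) + extD n (-(r • x)) := by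
  simp only [extD, LinearMap.mulLeft_apply, map_sub, map_smul, mul_sub, sub_mul,
    smul_mul_assoc, mul_smul_comm, mul_neg]
  abel

lemma sec_sub (n : ℕ) (hn : 1 ≤ n) (x) :
    ExteriorAlgebra.map (sec n hn) (qMap n x) - x ∈ LinearMap.range (extD n) := by
  induction x using CliffordAlgebra.left_induction with
  | algebraMap r =>
    change ExteriorAlgebra.map (sec n hn) (qMap n
      (algebraMap ℚ (ExteriorAlgebra ℚ (Fin n → ℚ)) r)) -
      algebraMap ℚ (ExteriorAlgebra ℚ (Fin n → ℚ)) r ∈ _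
    rw [AlgHom.commutes, AlgHom.commutes, sub_self]
    exact Submodule.zero_mem _
  | add x y hx hy =>
    rw [map_add, map_add, add_sub_add_comm]
    exact Submodule.add_mem _ hx hy
  | ι_mul x v hx =>
    change ExteriorAlgebra.map (sec n hn) (qMap n (ExteriorAlgebra.ι ℚ v * x))
      - ExteriorAlgebra.ι ℚ v * x ∈ _
    rw [map_mul, map_mul, ExteriorAlgebra.map_apply_ι, ExteriorAlgebra.map_apply_ι, sec_mk]
    set w := v - v ⟨0, hn⟩ • Δvec n with hw
    set y := ExteriorAlgebra.map (sec n hn) (qMap n x) with hy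
    have := sec_alg n v (v ⟨0, hn⟩) x y
    rw [← hw] at this
    refine (congrArg (· ∈ LinearMap.range (extD n)) this).mpr ?_
    exact Submodule.add_mem _ (range_mul n w _ hx) ⟨_, rfl⟩

lemma qMap_ker (n : ℕ) (hn : 1 ≤ n) :
    LinearMap.ker (qMap n).toLinearMap = LinearMap.range (extD n) := by
  apply le_antisymm
  · intro x hx
    have h := sec_sub n hn x
    have hx' : qMap n x = 0 := hx
    rw [hx', map_zero, zero_sub] at h
    exact (Submodule.neg_mem_iff _).mp h
  · rintro _ ⟨y, rfl⟩
    change qMap n (ExteriorAlgebra.ι ℚ (Δvec n) * y) = 0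
    rw [map_mul, ExteriorAlgebra.map_apply_ι]
    have : (Submodule.span ℚ {Δvec n}).mkQ (Δvec n) = 0 := by
      simpa using Submodule.subset_span (Set.mem_singleton _)
    rw [this, map_zero, zero_mul]

lemma qMap_surj (n : ℕ) : Function.Surjective (qMap n) :=
  ExteriorAlgebra.map_surjective_iff.mpr (Submodule.mkQ_surjective _)

lemma qMap_act (n : ℕ) (σ : Equiv.Perm (Fin n)) (x) :
    qMap n (extAct n σ x) = extQAct n σ (qMap n x) := by
  change (qMap n).comp (ExteriorAlgebra.map _) x = (ExteriorAlgebra.map _).comp (qMap n) x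
  congr 1
  rw [ExteriorAlgebra.map_comp_map, ExteriorAlgebra.map_comp_map]
  congr 1

theorem cube_equivariant_iso_exterior (n : ℕ) (hn : 1 ≤ n) :
    -- `D^{⊗n}` is `Σ_n`-equivariantly isomorphic, as a complex, to `(Λ(ℚ^n), Δ ∧ -)`:
    (∃ φ : Cube n ≃ₗ[ℚ] ExteriorAlgebra ℚ (Fin n → ℚ),
        φ.toLinearMap ∘ₗ cubeD n = extD n ∘ₗ φ.toLinearMap ∧
        ∀ σ : Equiv.Perm (Fin n),
          φ.toLinearMap ∘ₗ cubeAct n σ = extAct n σ ∘ₗ φ.toLinearMap) ∧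
    -- the cohomology of `D^{⊗n}` vanishes:
    (cubeD n ∘ₗ cubeD n = 0 ∧ LinearMap.ker (cubeD n) ≤ LinearMap.range (cubeD n)) ∧
    -- the quotient `D^{⊗n}/d(D^{⊗n})` is `Σ_n`-equivariantly isomorphic to `Λ(ℚ^n/Δ)`:
    (∃ ψ : (Cube n ⧸ LinearMap.range (cubeD n)) ≃ₗ[ℚ] ExteriorAlgebra ℚ (StdRep n),
        ∀ σ : Equiv.Perm (Fin n),
          ψ.toLinearMap ∘ₗ (LinearMap.range (cubeD n)).mkQ ∘ₗ cubeAct n σ =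
            extQAct n σ ∘ₗ ψ.toLinearMap ∘ₗ (LinearMap.range (cubeD n)).mkQ) := by
  let φ : Cube n ≃ₗ[ℚ] ExteriorAlgebra ℚ (Fin n → ℚ) := (LinearEquiv.ofBijective (Θ n) (Θ_bij n)).symm
  have hφ : ∀ x, Θ n (φ x) = x := fun x =>
    (LinearEquiv.ofBijective (Θ n) (Θ_bij n)).apply_symm_apply x
  have hφ' : ∀ x, φ (Θ n x) = x := fun x =>
    (LinearEquiv.ofBijective (Θ n) (Θ_bij n)).symm_apply_apply x
  have hD : ∀ f, φ (cubeD n f) = extD n (φ f) := fun f => by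
    rw [← hφ' (extD n (φ f)), Θ_D, hφ]
  have hA : ∀ σ f, φ (cubeAct n σ f) = extAct n σ (φ f) := fun σ f => by
    rw [← hφ' (extAct n σ (φ f)), Θ_act, hφ]
  refine ⟨⟨φ, LinearMap.ext hD, fun σ => LinearMap.ext (hA σ)⟩, ⟨?_, ?_⟩, ?_⟩
  · refine LinearMap.ext fun f => φ.injective ?_
    rw [LinearMap.comp_apply, hD, hD, extD_sq, LinearMap.zero_apply, map_zero]
  · intro f hf
    have hf' : cubeD n f = 0 := hf
    obtain ⟨y, hy⟩ := extD_exact n hn (φ f) (by rw [← hD, hf', map_zero])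
    exact ⟨Θ n y, by rw [← Θ_D, hy, hφ]⟩
  · let q : Cube n →ₗ[ℚ] ExteriorAlgebra ℚ (StdRep n) := (qMap n).toLinearMap ∘ₗ φ.toLinearMap
    have hq : Function.Surjective q := (qMap_surj n).comp φ.surjective
    have hk : LinearMap.range (cubeD n) = LinearMap.ker q := by
      ext f
      have : f ∈ LinearMap.ker q ↔ φ f ∈ LinearMap.ker (qMap n).toLinearMap := Iff.rfl
      rw [this, qMap_ker n hn]
      constructor
      · rintro ⟨y, rfl⟩
        exact ⟨φ y, (hD y).symm⟩
      · rintro ⟨y, hy⟩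
        exact ⟨Θ n y, by rw [← Θ_D, hy, hφ]⟩
    refine ⟨(Submodule.quotEquivOfEq _ _ hk).trans (q.quotKerEquivOfSurjective hq), fun σ => ?_⟩
    refine LinearMap.ext fun f => ?_
    change q (cubeAct n σ f) = extQAct n σ (q f)
    change qMap n (φ (cubeAct n σ f)) = extQAct n σ (qMap n (φ f))
    rw [hA, qMap_act]
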